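/- Let G be a graph with a nonnegative real weight function w on its vertices and let (X1, X2) be an odd 2-join of G with associated sets A1, B1, C1, A2, B2, C2, i.e. a 2-join such that every chordless path of G[X1] from a vertex of A1 to a vertex of B1 with all internal vertices in C1 has odd length. Then α_C + α_X ≤ α_AC + α_BC. -/

import Mathlib

open SimpleGraph

/-- A 2-join `(X1, X2)` of `G` with split sets `A1, B1 ⊆ X1` and `A2, B2 ⊆ X2`. -/
def IsTwoJoin {V : Type} [Fintype V] [DecidableEq V] (G : SimpleGraph V)
    (X1 X2 A1 B1 A2 B2 : Finset V) : Prop :=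
  Disjoint X1 X2 ∧ X1 ∪ X2 = Finset.univ ∧
  A1 ⊆ X1 ∧ B1 ⊆ X1 ∧ A2 ⊆ X2 ∧ B2 ⊆ X2 ∧
  A1.Nonempty ∧ B1.Nonempty ∧ A2.Nonempty ∧ B2.Nonempty ∧
  Disjoint A1 B1 ∧ Disjoint A2 B2 ∧
  (∀ x ∈ X1, ∀ y ∈ X2, G.Adj x y ↔ ((x ∈ A1 ∧ y ∈ A2) ∨ (x ∈ B1 ∧ y ∈ B2))) ∧
  3 ≤ X1.card ∧ 3 ≤ X2.card ∧
  (∀ v (hv : v ∈ X1),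
    (∃ a, ∃ ha : a ∈ X1, a ∈ A1 ∧
      (G.induce (X1 : Set V)).Reachable ⟨v, hv⟩ ⟨a, ha⟩) ∧
    (∃ c, ∃ hc : c ∈ X1, c ∈ B1 ∧
      (G.induce (X1 : Set V)).Reachable ⟨v, hv⟩ ⟨c, hc⟩)) ∧
  (∀ v (hv : v ∈ X2),
    (∃ a, ∃ ha : a ∈ X2, a ∈ A2 ∧
      (G.induce (X2 : Set V)).Reachable ⟨v, hv⟩ ⟨a, ha⟩) ∧
    (∃ c, ∃ hc : c ∈ X2, c ∈ B2 ∧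
      (G.induce (X2 : Set V)).Reachable ⟨v, hv⟩ ⟨c, hc⟩)) ∧
  ¬ (∃ p q r : V, A1 = {p} ∧ B1 = {r} ∧ X1 = {p, q, r} ∧
      p ≠ q ∧ q ≠ r ∧ p ≠ r ∧ G.Adj p q ∧ G.Adj q r ∧ ¬ G.Adj p r) ∧
  ¬ (∃ p q r : V, A2 = {p} ∧ B2 = {r} ∧ X2 = {p, q, r} ∧
      p ≠ q ∧ q ≠ r ∧ p ≠ r ∧ G.Adj p q ∧ G.Adj q r ∧ ¬ G.Adj p r)

/-- A stable (independent) finite set of vertices. -/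
def IsStableFinset {V : Type} (G : SimpleGraph V) (S : Finset V) : Prop :=
  ∀ a ∈ S, ∀ b ∈ S, ¬ G.Adj a b

/-- The maximum weight of a stable set of `G` contained in `X`. -/
noncomputable def maxStableWeight {V : Type} (G : SimpleGraph V) (w : V → ℝ)
    (X : Finset V) : ℝ :=
  sSup {r : ℝ | ∃ S : Finset V, S ⊆ X ∧ IsStableFinset G S ∧ r = ∑ v ∈ S, w v}

/-- `f 0, …, f n` is a walk of `G` from `A` to `B` all of whose vertices lie in `Y`. -/
def IsWalkSeq {V : Type} (G : SimpleGraph V) (Y A B : Set V) (n : ℕ) (f : ℕ → V) : Prop :=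
  f 0 ∈ A ∧ f n ∈ B ∧ (∀ i < n, G.Adj (f i) (f (i + 1))) ∧ ∀ i ≤ n, f i ∈ Y

/-- Skipping the `d` vertices after position `i` of a walk gives a walk, provided that
the two sides of the gap are adjacent. -/
lemma IsWalkSeq.skip {V : Type} {G : SimpleGraph V} {Y A B : Set V} {n : ℕ} {f : ℕ → V}
    (h : IsWalkSeq G Y A B n f) {i d : ℕ} (hid : i + d + 1 ≤ n)
    (hadj : G.Adj (f i) (f (i + d + 1))) :
    IsWalkSeq G Y A B (n - d) (fun k => if k ≤ i then f k else f (k + d)) := by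
  obtain ⟨h0, hn, ha, hY⟩ := h
  refine ⟨by simpa using h0, ?_, ?_, ?_⟩
  · have h1 : ¬ n - d ≤ i := by omega
    have h2 : n - d + d = n := by omega
    simpa [h1, h2] using hn
  · intro k hk
    rcases lt_trichotomy k i with hki | rfl | hki
    · simpa [hki.le, Nat.succ_le_of_lt hki] using ha k (by omega)
    · simpa [add_right_comm] using hadj
    · have h1 : ¬ k ≤ i := by omega
      have h2 : ¬ k + 1 ≤ i := by omega
      simpa [h1, h2, add_right_comm] using ha (k + d) (by omega)
  · intro k hk
    by_cases hki : k ≤ i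
    · simpa [hki] using hY k (by omega)
    · simpa [hki] using hY (k + d) (by omega)

lemma IsWalkSeq.take {V : Type} {G : SimpleGraph V} {Y A B : Set V} {n : ℕ} {f : ℕ → V}
    (h : IsWalkSeq G Y A B n f) {i : ℕ} (hi : i ≤ n) (hB : f i ∈ B) :
    IsWalkSeq G Y A B i f :=
  ⟨h.1, hB, fun k hk => h.2.2.1 k (by omega), fun k hk => h.2.2.2 k (by omega)⟩

lemma IsWalkSeq.drop {V : Type} {G : SimpleGraph V} {Y A B : Set V} {n : ℕ} {f : ℕ → V}
    (h : IsWalkSeq G Y A B n f) {i : ℕ} (hi : i ≤ n) (hA : f i ∈ A) :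
    IsWalkSeq G Y A B (n - i) (fun k => f (k + i)) := by
  obtain ⟨-, hn, ha, hY⟩ := h
  refine ⟨by simpa using hA, ?_, fun k hk => ?_, fun k hk => hY _ (by omega)⟩
  · simpa [Nat.sub_add_cancel hi] using hn
  · simpa [add_right_comm] using ha (k + i) (by omega)

/-- A walk between disjoint sets `A` and `B` of minimum length is a chordless path with
no internal vertex in `A ∪ B`. -/
lemma exists_pathGraph_embedding {V : Type} {G : SimpleGraph V} {Y A B : Set V}
    (hAB : Disjoint A B) (h : ∃ n f, IsWalkSeq G Y A B n f) :
    ∃ (n : ℕ) (f : ℕ → V) (g : pathGraph (n + 1) ↪g G), IsWalkSeq G Y A B n f ∧ 1 ≤ n ∧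
      (∀ x, g x = f x) ∧ ∀ i, i ≠ 0 → i < n → f i ∉ A ∧ f i ∉ B := by
  classical
  have hmin : ∀ k < Nat.find h, ∀ f, ¬ IsWalkSeq G Y A B k f :=
    fun k hk f hf => Nat.find_min h hk ⟨f, hf⟩
  obtain ⟨f, hf⟩ := Nat.find_spec h
  set n := Nat.find h
  have hpos : 1 ≤ n := by
    rcases Nat.eq_zero_or_pos n with h0 | h0
    · have hB := hf.2.1
      rw [h0] at hB
      exact absurd hB (Set.disjoint_left.1 hAB hf.1)
    · exact h0
  have hint : ∀ i, i ≠ 0 → i < n → f i ∉ A ∧ f i ∉ B := fun i hi hin =>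
    ⟨fun hA => hmin _ (by omega) _ (hf.drop hin.le hA), fun hB => hmin _ hin _ (hf.take hin.le hB)⟩
  have hchord : ∀ i j, i + 1 < j → j ≤ n → ¬ G.Adj (f i) (f j) := by
    intro i j hij hj hadj
    obtain ⟨d, rfl⟩ : ∃ d, j = i + d + 1 := ⟨j - i - 1, by omega⟩
    exact hmin _ (by omega) _ (hf.skip (i := i) (d := d) hj hadj)
  have hinj : ∀ i j, i < j → j ≤ n → f i ≠ f j := by
    intro i j hij hj heq
    rcases hj.lt_or_eq with hj' | rfl
    · exact hchord i (j + 1) (by omega) hj' (heq ▸ hf.2.2.1 j hj')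
    · exact hmin i hij _ (hf.take hij.le (heq ▸ hf.2.1))
  have hadj : ∀ i j, i < j → j ≤ n → (G.Adj (f i) (f j) ↔ i + 1 = j) := by
    intro i j hij hj
    constructor
    · intro ha
      by_contra hne
      exact hchord i j (by omega) hj ha
    · rintro rfl
      exact hf.2.2.1 i (by omega)
  refine ⟨n, f, ⟨⟨fun x => f x, ?_⟩, ?_⟩, hf, hpos, fun x => rfl, hint⟩
  · intro x y hxy
    by_contra hne
    rcases lt_or_gt_of_ne (fun hv => hne (Fin.ext hv) : x.val ≠ y.val) with hlt | hlt
    · exact hinj _ _ hlt (by omega) hxy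
    · exact hinj _ _ hlt (by omega) hxy.symm
  · intro x y
    rw [pathGraph_adj]
    change G.Adj (f x) (f y) ↔ _
    rcases lt_trichotomy x.val y.val with hlt | heq | hlt
    · rw [hadj _ _ hlt (by omega)]
      omega
    · simp [heq]
    · rw [G.adj_comm, hadj _ _ hlt (by omega)]
      omega

lemma sum_le_maxStableWeight {V : Type} [Fintype V] {G : SimpleGraph V} (w : V → ℝ)
    {X S : Finset V} (hSX : S ⊆ X) (hS : IsStableFinset G S) :
    ∑ v ∈ S, w v ≤ maxStableWeight G w X := by
  refine le_csSup (Set.Finite.bddAbove ?_) ⟨S, hSX, hS, rfl⟩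
  refine (Set.finite_range fun S : Finset V => ∑ v ∈ S, w v).subset ?_
  rintro r ⟨S, -, -, rfl⟩
  exact ⟨S, rfl⟩

lemma exists_sum_eq_maxStableWeight {V : Type} [Fintype V] (G : SimpleGraph V) (w : V → ℝ)
    (X : Finset V) :
    ∃ S ⊆ X, IsStableFinset G S ∧ maxStableWeight G w X = ∑ v ∈ S, w v := by
  have hfin : {r : ℝ | ∃ S : Finset V, S ⊆ X ∧ IsStableFinset G S ∧ r = ∑ v ∈ S, w v}.Finite := by
    refine (Set.finite_range fun S : Finset V => ∑ v ∈ S, w v).subset ?_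
    rintro r ⟨S, -, -, rfl⟩
    exact ⟨S, rfl⟩
  have hne : {r : ℝ | ∃ S : Finset V, S ⊆ X ∧ IsStableFinset G S ∧
      r = ∑ v ∈ S, w v}.Nonempty :=
    ⟨0, ∅, by simp, by simp [IsStableFinset], by simp⟩
  exact hne.csSup_mem hfin

/-- Exchanging two stable sets `S` and `T` on a set `W` closed under adjacency inside
`S ∪ T` gives a stable set. -/
lemma isStableFinset_exchange {V : Type} [DecidableEq V] {G : SimpleGraph V} {S T : Finset V}
    (hS : IsStableFinset G S) (hT : IsStableFinset G T) {W : V → Prop} [DecidablePred W]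
    (hW : ∀ u v, W u → G.Adj u v → v ∈ S ∪ T → W v) :
    IsStableFinset G (S.filter W ∪ T.filter (¬ W ·)) := by
  intro a ha b hb hab
  simp only [Finset.mem_union, Finset.mem_filter] at ha hb
  rcases ha with ⟨haS, haW⟩ | ⟨haT, haW⟩ <;> rcases hb with ⟨hbS, hbW⟩ | ⟨hbT, hbW⟩
  · exact hS a haS b hbS hab
  · exact hbW (hW a b haW hab (Finset.mem_union_right _ hbT))
  · exact haW (hW b a hbW hab.symm (Finset.mem_union_right _ haT))
  · exact hT a haT b hbT hab

lemma sum_exchange {V : Type} [DecidableEq V] (w : V → ℝ) (S T : Finset V) (W : V → Prop)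
    [DecidablePred W] :
    ∑ v ∈ S.filter W ∪ T.filter (¬ W ·), w v + ∑ v ∈ T.filter W ∪ S.filter (¬ W ·), w v =
      ∑ v ∈ S, w v + ∑ v ∈ T, w v := by
  rw [Finset.sum_union (Finset.disjoint_filter_filter_not S T W),
    Finset.sum_union (Finset.disjoint_filter_filter_not T S W),
    ← Finset.sum_filter_add_sum_filter_not S W, ← Finset.sum_filter_add_sum_filter_not T W]
  ring

/-- For an odd 2-join (every chordless path of `G[X1]` from `A1` to `B1` with
internal vertices in `C1 = X1 \ (A1 ∪ B1)` has odd length),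
`α_C + α_X ≤ α_AC + α_BC` (Trotignon and Vušković). -/
theorem odd_two_join_stable_set_inequality {V : Type} [Fintype V]
    [DecidableEq V] (G : SimpleGraph V) (w : V → ℝ) (hw : ∀ v, 0 ≤ w v)
    (X1 X2 A1 B1 A2 B2 : Finset V) (h2j : IsTwoJoin G X1 X2 A1 B1 A2 B2)
    (hodd : ∀ (m : ℕ) (hm : 2 ≤ m) (g : pathGraph m ↪g G),
        (∀ x : Fin m, (g x : V) ∈ X1) →
        (g ⟨0, by omega⟩ : V) ∈ A1 → (g ⟨m - 1, by omega⟩ : V) ∈ B1 →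
        (∀ x : Fin m, x.val ≠ 0 → x.val ≠ m - 1 → (g x : V) ∈ X1 \ (A1 ∪ B1)) →
        Odd (m - 1)) :
    maxStableWeight G w (X1 \ (A1 ∪ B1)) + maxStableWeight G w X1 ≤
      maxStableWeight G w (A1 ∪ (X1 \ (A1 ∪ B1))) +
      maxStableWeight G w (B1 ∪ (X1 \ (A1 ∪ B1))) := by
  classical
  obtain ⟨-, -, hA1, hB1, -, -, -, -, -, -, hAB, -⟩ := h2j
  obtain ⟨T, hTC, hT, hTw⟩ := exists_sum_eq_maxStableWeight G w (X1 \ (A1 ∪ B1))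
  obtain ⟨S, hSX, hS, hSw⟩ := exists_sum_eq_maxStableWeight G w X1
  have hTA : ∀ v ∈ T, v ∉ A1 ∧ v ∉ B1 := fun v hv => by
    simpa using (Finset.mem_sdiff.1 (hTC hv)).2
  have hTX : T ⊆ X1 := hTC.trans Finset.sdiff_subset
  -- No walk of `G[S ∪ T]` joins `A1` to `B1`.
  have hno : ¬ ∃ n f, IsWalkSeq G (↑(S ∪ T)) (↑A1) (↑B1) n f := by
    intro h
    obtain ⟨n, f, g, ⟨h0, hn, hadj, hY⟩, hpos, hgf, hint⟩ :=
      exists_pathGraph_embedding (Finset.disjoint_coe.2 hAB) h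
    have hX : ∀ i ≤ n, f i ∈ X1 := fun i hi =>
      Finset.union_subset hSX hTX (Finset.mem_coe.1 (hY i hi))
    have hpar : ∀ i ≤ n, (Even i → f i ∈ S) ∧ (Odd i → f i ∈ T) := by
      intro i
      induction i with
      | zero =>
        refine fun hi => ⟨fun _ => ?_, fun ho => by simp at ho⟩
        exact (Finset.mem_union.1 (Finset.mem_coe.1 (hY 0 hi))).resolve_right
          fun hT0 => (hTA _ hT0).1 h0
      | succ k ih =>
        intro hi
        have ih := ih (by omega)
        have ha := hadj k (by omega)
        have hm := Finset.mem_union.1 (Finset.mem_coe.1 (hY (k + 1) hi))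
        refine ⟨fun he => hm.resolve_right fun h' => ?_, fun ho => hm.resolve_left fun h' => ?_⟩
        · exact hT _ (ih.2 (by grind)) _ h' ha
        · exact hS _ (ih.1 (by grind)) _ h' ha
    have hon : Odd (n + 1 - 1) := by
      refine hodd (n + 1) (by omega) g (fun x => ?_) ?_ ?_ (fun x hx0 hxn => ?_)
      · rw [hgf]
        exact hX _ (by omega)
      · rw [hgf]
        exact h0
      · rw [hgf]
        exact hn
      · have hxi := hint x.val hx0 (by omega)
        rw [hgf]
        refine Finset.mem_sdiff.2 ⟨hX _ (by omega), ?_⟩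
        simpa using hxi
    exact (hTA _ ((hpar n le_rfl).2 hon)).2 hn
  let W : V → Prop := fun v => ∃ n f, IsWalkSeq G (↑(S ∪ T)) (↑A1) {v} n f
  have hW : ∀ u v, W u → G.Adj u v → v ∈ S ∪ T → W v := by
    rintro u v ⟨n, f, h0, hn, hadj, hY⟩ huv hv
    refine ⟨n + 1, fun k => if k ≤ n then f k else v, by simpa using h0, by simp,
      fun i hi => ?_, fun i hi => ?_⟩
    · rcases (Nat.lt_succ_iff.1 hi).lt_or_eq with hi' | rfl
      · simpa [hi'.le, Nat.succ_le_of_lt hi'] using hadj i hi'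
      · rw [Set.mem_singleton_iff] at hn
        simpa [hn] using huv
    · by_cases hin : i ≤ n
      · simpa [hin] using hY i hin
      · simpa [hin] using hv
  have hWA : ∀ v ∈ S, v ∈ A1 → W v := fun v hv hvA =>
    ⟨0, fun _ => v, hvA, rfl, by simp, fun _ _ => by simp [hv]⟩
  have hWB : ∀ v, v ∈ B1 → ¬ W v := by
    rintro v hvB ⟨n, f, h0, hn, h⟩
    exact hno ⟨n, f, h0, Set.mem_singleton_iff.1 hn ▸ hvB, h⟩
  clear_value W
  have h1 := sum_le_maxStableWeight w (X := A1 ∪ (X1 \ (A1 ∪ B1)))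
    (S := S.filter W ∪ T.filter (¬ W ·)) (by
      intro v hv
      have := @hSX v
      have := @hTC v
      have := hWB v
      simp only [Finset.mem_union, Finset.mem_filter, Finset.mem_sdiff] at *
      tauto) (isStableFinset_exchange hS hT hW)
  have h2 := sum_le_maxStableWeight w (X := B1 ∪ (X1 \ (A1 ∪ B1)))
    (S := T.filter W ∪ S.filter (¬ W ·)) (by
      intro v hv
      have := @hSX v
      have := @hTC v
      have := hWA v
      simp only [Finset.mem_union, Finset.mem_filter, Finset.mem_sdiff] at *
      tauto) (isStableFinset_exchange hT hS (by simpa only [Finset.union_comm T S] using hW))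
  have h3 := sum_exchange w S T W
  linarith
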